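/- arXiv:2101.03739 — 2 statements merged into one kernel-verified Lean document; each statement's English description precedes it below -/
import Mathlib

section
/- If SOL^s(K_∞, f^∞) = {0}, then for every i ∈ {1, …, s} the scalar minimization problem of f_i^∞ on K_∞ has a solution, i.e., SOL(K_∞, f_i^∞) ≠ ∅. -/
open Filter Topology MvPolynomial

/-- The asymptotic cone of a set `K ⊆ ℝⁿ`:
`K_∞ = {v : ∃ t_k → +∞, x_k ∈ K with x_k / t_k → v}`. -/
def asympCone {n : ℕ} (K : Set (Fin n → ℝ)) : Set (Fin n → ℝ) :=
  {v | ∃ (t : ℕ → ℝ) (x : ℕ → (Fin n → ℝ)), (∀ k, x k ∈ K) ∧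
    Tendsto t atTop atTop ∧ Tendsto (fun k => (t k)⁻¹ • x k) atTop (nhds v)}

/-- The weak Pareto efficient solution set of the vector function `p` on `C`:
`x* ∈ C` such that for no `x ∈ C` we have `p(x) - p(x*) ∈ -int ℝˢ₊`. -/
def SOLw {n s : ℕ} (C : Set (Fin n → ℝ)) (p : Fin s → (Fin n → ℝ) → ℝ) : Set (Fin n → ℝ) :=
  {x | x ∈ C ∧ ∀ y ∈ C, ¬ (∀ i, p i y < p i x)}

/-- The Pareto efficient solution set of the vector function `p` on `C`:
`x* ∈ C` such that for no `x ∈ C` we have `p(x) - p(x*) ∈ -ℝˢ₊ \ {0}`. -/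
def SOLs {n s : ℕ} (C : Set (Fin n → ℝ)) (p : Fin s → (Fin n → ℝ) → ℝ) : Set (Fin n → ℝ) :=
  {x | x ∈ C ∧ ∀ y ∈ C, ¬ ((∀ i, p i y ≤ p i x) ∧ (∃ i, p i y < p i x))}

/-- The set of global minimizers of the scalar function `q` on `C`. -/
def SOLmin {n : ℕ} (C : Set (Fin n → ℝ)) (q : (Fin n → ℝ) → ℝ) : Set (Fin n → ℝ) :=
  {x | x ∈ C ∧ ∀ y ∈ C, q x ≤ q y}

/-- The recession polynomial (vector leading term) of `p`, as a function:
`p^∞(x) = lim_{λ→+∞} p(λx)/λ^{deg p}`, i.e. the evaluation of the homogeneous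
component of `p` of top degree. -/
noncomputable def recFn {n : ℕ} (p : MvPolynomial (Fin n) ℝ) : (Fin n → ℝ) → ℝ :=
  fun x => eval x (homogeneousComponent p.totalDegree p)

/-- Evaluation of a polynomial, as a function `ℝⁿ → ℝ`. -/
noncomputable def evalFn {n : ℕ} (p : MvPolynomial (Fin n) ℝ) : (Fin n → ℝ) → ℝ :=
  fun x => eval x p

/-- `⟨∇p^∞(x), y⟩`: the inner product of the gradient of the recession polynomial
of `p` at `x` with `y`. -/
noncomputable def gradRecInner {n : ℕ} (p : MvPolynomial (Fin n) ℝ) (x y : Fin n → ℝ) : ℝ :=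
  ∑ j, (eval x (pderiv j (homogeneousComponent p.totalDegree p))) * y j

/-- `x` is a solution of the weak vector complementarity problem
`WVCP(C, ∇f^∞)`. -/
def isWVCPsol {n s : ℕ} (C : Set (Fin n → ℝ)) (f : Fin s → MvPolynomial (Fin n) ℝ)
    (x : Fin n → ℝ) : Prop :=
  x ∈ C ∧ (∀ y ∈ C, ¬ (∀ i, gradRecInner (f i) x y < 0)) ∧
    ¬ (∀ i, 0 < gradRecInner (f i) x x)

lemma mem_asympCone_iff {n : ℕ} (K : Set (Fin n → ℝ)) (v : Fin n → ℝ) :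
    v ∈ asympCone K ↔ ∀ m : ℕ, ∃ t : ℝ, ∃ x ∈ K, (m : ℝ) ≤ t ∧
      dist (t⁻¹ • x) v < 1 / ((m : ℝ) + 1) := by
  constructor
  · rintro ⟨t, x, hx, ht, hv⟩ m
    have h1 := ht.eventually_ge_atTop (m : ℝ)
    have h2 := (Metric.tendsto_nhds.1 hv) (1 / ((m : ℝ) + 1)) (by positivity)
    obtain ⟨k, hk1, hk2⟩ := (h1.and h2).exists
    exact ⟨t k, x k, hx k, hk1, hk2⟩
  · intro h
    choose t x hx ht hd using h
    refine ⟨t, x, hx, tendsto_atTop_mono ht tendsto_natCast_atTop_atTop, ?_⟩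
    rw [tendsto_iff_dist_tendsto_zero]
    exact squeeze_zero (fun _ => dist_nonneg) (fun k => (hd k).le)
      tendsto_one_div_add_atTop_nhds_zero_nat

lemma isClosed_asympCone {n : ℕ} (K : Set (Fin n → ℝ)) : IsClosed (asympCone K) := by
  apply isClosed_of_closure_subset
  intro v hv
  rw [mem_asympCone_iff]
  intro m
  have hpos : 0 < 1 / ((m : ℝ) + 1) := by positivity
  obtain ⟨w, hw, hd⟩ := Metric.mem_closure_iff.1 hv (1 / ((m : ℝ) + 1) / 2) (by positivity)
  obtain ⟨t, x, hx, ht, hq⟩ := (mem_asympCone_iff K w).1 hw (2 * m + 1)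
  refine ⟨t, x, hx, ?_, ?_⟩
  · push_cast at ht
    have : (0 : ℝ) ≤ m := Nat.cast_nonneg m
    linarith
  · have h3 : 1 / (((2 * m + 1 : ℕ) : ℝ) + 1) = 1 / ((m : ℝ) + 1) / 2 := by
      push_cast
      field_simp
      ring
    rw [h3] at hq
    have := dist_triangle (t⁻¹ • x) w v
    rw [dist_comm] at hd
    linarith

lemma smul_mem_asympCone {n : ℕ} (K : Set (Fin n → ℝ)) {v : Fin n → ℝ}
    (hv : v ∈ asympCone K) {c : ℝ} (hc : 0 < c) : c • v ∈ asympCone K := by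
  obtain ⟨t, x, hx, ht, hl⟩ := hv
  refine ⟨fun k => c⁻¹ * t k, x, hx, ht.const_mul_atTop (inv_pos.2 hc), ?_⟩
  have := hl.const_smul c
  refine this.congr fun k => ?_
  simp [mul_smul, mul_comm]

lemma recFn_smul {n : ℕ} (p : MvPolynomial (Fin n) ℝ) (c : ℝ) (x : Fin n → ℝ) :
    recFn p (c • x) = c ^ p.totalDegree * recFn p x := by
  have hh := homogeneousComponent_isHomogeneous p.totalDegree p
  simp only [recFn, eval_eq, Finset.mul_sum]
  refine Finset.sum_congr rfl fun d hd => ?_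
  have h1 : ∑ i ∈ d.support, d i = p.totalDegree := by
    have := hh (mem_support_iff.1 hd)
    rw [← this]
    simp [Finsupp.weight_apply, Finsupp.sum]
  simp only [Pi.smul_apply, smul_eq_mul, mul_pow, Finset.prod_mul_distrib,
    Finset.prod_pow_eq_pow_sum, h1]
  ring

lemma continuous_recFn {n : ℕ} (p : MvPolynomial (Fin n) ℝ) : Continuous (recFn p) :=
  MvPolynomial.continuous_eval _

theorem stmt5 {n s : ℕ} (hs : 0 < s) (K : Set (Fin n → ℝ)) (hK : K.Nonempty) (hKc : IsClosed K)
    (f : Fin s → MvPolynomial (Fin n) ℝ) (hdeg : ∀ i, 1 ≤ (f i).totalDegree)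
    (h : SOLs (asympCone K) (fun i => recFn (f i)) = {0}) :
    ∀ i, (SOLmin (asympCone K) (recFn (f i))).Nonempty := by
  intro i
  have hmem0 : (0 : Fin n → ℝ) ∈ SOLs (asympCone K) (fun i => recFn (f i)) := by rw [h]; rfl
  have hz : ∀ j, recFn (f j) 0 = 0 := by
    intro j
    have := recFn_smul (f j) 0 0
    rw [zero_pow (by have := hdeg j; omega)] at this
    simpa using this
  -- the only nonpositive point is zero
  have hnp : ∀ u ∈ asympCone K, (∀ j, recFn (f j) u ≤ 0) → u = 0 := by
    intro u hu hle
    have heq : ∀ j, recFn (f j) u = 0 := by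
      intro j
      by_contra hne
      exact hmem0.2 u hu ⟨fun k => by simpa [hz] using hle k,
        j, by simpa [hz] using lt_of_le_of_ne (hle j) hne⟩
    have : u ∈ SOLs (asympCone K) (fun i => recFn (f i)) := by
      refine ⟨hu, fun y hy hc => hmem0.2 y hy ?_⟩
      simpa [hz, heq] using hc
    rw [h] at this
    exact this
  refine ⟨0, hmem0.1, fun v hv => ?_⟩
  let S : Set (Fin n → ℝ) := asympCone K ∩ {y | ∀ j, recFn (f j) y ≤ recFn (f j) v}
  have hSc : IsClosed S := by
    refine (isClosed_asympCone K).inter ?_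
    simp only [Set.setOf_forall]
    exact isClosed_iInter fun j => isClosed_le (continuous_recFn _) continuous_const
  have hSb : Bornology.IsBounded S := by
    by_contra hb
    have hex : ∀ k : ℕ, ∃ y ∈ S, (k : ℝ) + 1 < ‖y‖ := by
      intro k
      by_contra! hcon
      exact hb (isBounded_iff_forall_norm_le.2 ⟨_, hcon⟩)
    choose y hyS hyn using hex
    have hypos : ∀ k, 0 < ‖y k‖ := fun k => lt_trans (by positivity) (hyn k)
    have hyt : Tendsto (fun k => ‖y k‖) atTop atTop :=
      tendsto_atTop_mono (fun k => by have := hyn k; linarith) tendsto_natCast_atTop_atTop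
    obtain ⟨u, hu, φ, hφ, hlim⟩ := (isCompact_sphere (0 : Fin n → ℝ) 1).tendsto_subseq
      (x := fun k => ‖y k‖⁻¹ • y k) (fun k => by
        simp [norm_smul, (hypos k).ne'])
    have huC : u ∈ asympCone K := (isClosed_asympCone K).mem_of_tendsto hlim
      (Eventually.of_forall fun k => smul_mem_asympCone K (hyS _).1 (inv_pos.2 (hypos _)))
    have hu0 : u = 0 := by
      refine hnp u huC fun j => ?_
      have hl1 := ((continuous_recFn (f j)).tendsto u).comp hlim
      have hl2 : Tendsto (fun k => (‖y (φ k)‖⁻¹) ^ (f j).totalDegree * recFn (f j) v)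
          atTop (𝓝 0) := by
        have h1 := (tendsto_inv_atTop_zero.comp (hyt.comp hφ.tendsto_atTop)).pow
          (f j).totalDegree
        rw [zero_pow (by have := hdeg j; omega)] at h1
        simpa using h1.mul_const (recFn (f j) v)
      refine le_of_tendsto_of_tendsto' hl1 hl2 fun k => ?_
      simp only [Function.comp, recFn_smul]
      exact mul_le_mul_of_nonneg_left ((hyS (φ k)).2 j) (by positivity)
    simp [hu0] at hu
  have hScomp : IsCompact S := Metric.isCompact_of_isClosed_isBounded hSc hSb
  obtain ⟨w, hwS, hw⟩ := hScomp.exists_isMinOn ⟨v, hv, fun j => le_rfl⟩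
    (f := fun x => ∑ j, recFn (f j) x)
    (continuous_finsetSum _ fun j _ => continuous_recFn (f j)).continuousOn
  have hwP : w ∈ SOLs (asympCone K) (fun i => recFn (f i)) := by
    refine ⟨hwS.1, ?_⟩
    rintro z hz' ⟨hle, j, hlt⟩
    have hzS : z ∈ S := ⟨hz', fun j => (hle j).trans (hwS.2 j)⟩
    have h1 := hw hzS
    have h2 : ∑ j, recFn (f j) z < ∑ j, recFn (f j) w :=
      Finset.sum_lt_sum (fun j _ => hle j) ⟨j, Finset.mem_univ _, hlt⟩
    exact absurd h2 (not_lt.2 h1)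
  rw [h] at hwP
  have hw0 : w = 0 := hwP
  have := hwS.2 i
  rwa [hw0] at this
end

section
/- If PVOP(K, f) is strongly regular (i.e., SOL^w(K_∞, f^∞) is bounded) and f is bounded from below on K, then SOL^s(K, f) is nonempty and SOL^w(K, f) is compact. -/
open Filter Topology MvPolynomial

lemma hom_eval_smul {n m : ℕ} {p : MvPolynomial (Fin n) ℝ} (hp : p.IsHomogeneous m)
    (c : ℝ) (x : Fin n → ℝ) : eval (c • x) p = c ^ m * eval x p := by
  rw [eval_eq, eval_eq, Finset.mul_sum]
  refine Finset.sum_congr rfl fun d hd => ?_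
  have h := hp.degree_eq_sum_deg_support hd
  simp only [Pi.smul_apply, smul_eq_mul, mul_pow, Finset.prod_mul_distrib]
  rw [Finset.prod_pow_eq_pow_sum, h]
  ring

lemma eval_cont {n : ℕ} (p : MvPolynomial (Fin n) ℝ) : Continuous fun x : Fin n → ℝ => eval x p :=
  MvPolynomial.continuous_eval p

lemma tendsto_rec {n : ℕ} (p : MvPolynomial (Fin n) ℝ) {t : ℕ → ℝ} {x : ℕ → Fin n → ℝ}
    {v : Fin n → ℝ} (ht : Tendsto t atTop atTop)
    (hx : Tendsto (fun k => (t k)⁻¹ • x k) atTop (nhds v)) :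
    Tendsto (fun k => ((t k)⁻¹) ^ p.totalDegree * eval (x k) p) atTop (nhds (recFn p v)) := by
  set d := p.totalDegree with hd
  have hinv : Tendsto (fun k => (t k)⁻¹) atTop (nhds 0) := tendsto_inv_atTop_zero.comp ht
  have key : ∀ j ∈ Finset.range (d + 1),
      Tendsto (fun k => ((t k)⁻¹) ^ (d - j) *
        eval ((t k)⁻¹ • x k) (homogeneousComponent j p)) atTop
        (nhds ((0 : ℝ) ^ (d - j) * eval v (homogeneousComponent j p))) := by
    intro j _
    exact (hinv.pow _).mul (((eval_cont _).tendsto v).comp hx)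
  have hs := tendsto_finsetSum _ key
  have e1 : (∑ j ∈ Finset.range (d + 1), (0 : ℝ) ^ (d - j) * eval v (homogeneousComponent j p))
      = recFn p v := by
    rw [Finset.sum_range_succ, Finset.sum_eq_zero]
    · simp [recFn, ← hd]
    · intro j hj
      have : d - j ≠ 0 := by have := Finset.mem_range.1 hj; omega
      simp [this]
  rw [e1] at hs
  refine hs.congr fun k => ?_
  conv_rhs => rw [← sum_homogeneousComponent p, map_sum, Finset.mul_sum, ← hd]
  refine Finset.sum_congr rfl fun j hj => ?_
  rw [hom_eval_smul (homogeneousComponent_isHomogeneous j p), ← mul_assoc, ← pow_add]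
  congr 2
  have := Finset.mem_range.1 hj
  omega

lemma rec_nonneg {n : ℕ} {K : Set (Fin n → ℝ)} (p : MvPolynomial (Fin n) ℝ)
    (hd : 1 ≤ p.totalDegree) {r : ℝ} (hr : ∀ x ∈ K, r ≤ evalFn p x) {v : Fin n → ℝ}
    (hv : v ∈ asympCone K) : 0 ≤ recFn p v := by
  obtain ⟨t, x, hxK, ht, hx⟩ := hv
  have h1 := tendsto_rec p ht hx
  have hinv : Tendsto (fun k => (t k)⁻¹) atTop (nhds 0) := tendsto_inv_atTop_zero.comp ht
  have h2 : Tendsto (fun k => ((t k)⁻¹) ^ p.totalDegree * r) atTop (nhds 0) := by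
    have := (hinv.pow p.totalDegree).mul_const r
    simpa [show p.totalDegree ≠ 0 by omega] using this
  refine le_of_tendsto_of_tendsto h2 h1 ?_
  filter_upwards [ht.eventually_ge_atTop 0] with k hk
  exact mul_le_mul_of_nonneg_left (hr _ (hxK k)) (by positivity)

lemma cone_smul {n : ℕ} {K : Set (Fin n → ℝ)} {v : Fin n → ℝ} (hv : v ∈ asympCone K)
    {c : ℝ} (hc : 0 < c) : c • v ∈ asympCone K := by
  obtain ⟨t, x, hxK, ht, hx⟩ := hv
  refine ⟨fun k => c⁻¹ * t k, x, hxK, ht.const_mul_atTop (by positivity), ?_⟩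
  refine (hx.const_smul c).congr fun k => ?_
  rw [smul_smul]; congr 1; simp [mul_comm]

lemma sublevel_bdd {n : ℕ} {K : Set (Fin n → ℝ)} (p : MvPolynomial (Fin n) ℝ)
    (hd : 1 ≤ p.totalDegree) (hpos : ∀ v ∈ asympCone K, v ≠ 0 → 0 < recFn p v) (c : ℝ) :
    Bornology.IsBounded {x | x ∈ K ∧ evalFn p x ≤ c} := by
  by_contra hb
  rw [isBounded_iff_forall_norm_le] at hb
  push Not at hb
  choose x hx hxn using fun k : ℕ => hb (k + 1)
  have hpos1 : ∀ k, 0 < ‖x k‖ := fun k => by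
    have := hxn k
    have : (0 : ℝ) ≤ k := Nat.cast_nonneg k
    linarith
  have ht : Tendsto (fun k => ‖x k‖) atTop atTop :=
    tendsto_atTop_mono (fun k => by have := hxn k; linarith) tendsto_natCast_atTop_atTop
  have hy : ∀ k, (‖x k‖)⁻¹ • x k ∈ Metric.sphere (0 : Fin n → ℝ) 1 := fun k => by
    simp [norm_smul, (hpos1 k).ne']
  obtain ⟨v, hv, φ, hφ, hlim⟩ := (isCompact_sphere (0 : Fin n → ℝ) 1).tendsto_subseq hy
  have ht' := ht.comp hφ.tendsto_atTop
  have hvK : v ∈ asympCone K := ⟨fun k => ‖x (φ k)‖, fun k => x (φ k), fun k => (hx _).1, ht', hlim⟩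
  have hv0 : v ≠ 0 := by
    rintro rfl
    simp at hv
  have h1 := tendsto_rec p (x := fun k => x (φ k)) ht' hlim
  have hinv := (tendsto_inv_atTop_zero (𝕜 := ℝ)).comp ht'
  have h2 : Tendsto (fun k => ((‖x (φ k)‖)⁻¹) ^ p.totalDegree * c) atTop (nhds 0) := by
    have := (hinv.pow p.totalDegree).mul_const c
    simpa [show p.totalDegree ≠ 0 by omega] using this
  have := le_of_tendsto_of_tendsto h1 h2 (Eventually.of_forall fun k =>
    mul_le_mul_of_nonneg_left (hx (φ k)).2 (by simp))
  exact absurd (hpos v hvK hv0) (not_lt.2 this)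

theorem stmt16 {n s : ℕ} (hs : 0 < s) (K : Set (Fin n → ℝ)) (hK : K.Nonempty) (hKc : IsClosed K)
    (f : Fin s → MvPolynomial (Fin n) ℝ) (hdeg : ∀ i, 1 ≤ (f i).totalDegree)
    (hreg : Bornology.IsBounded (SOLw (asympCone K) (fun i => recFn (f i))))
    (hbdd : ∃ r : Fin s → ℝ, ∀ x ∈ K, ∀ i, r i ≤ evalFn (f i) x) :
    (SOLs K (fun i => evalFn (f i))).Nonempty ∧ IsCompact (SOLw K (fun i => evalFn (f i))) := by
  obtain ⟨r, hr⟩ := hbdd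
  have hnn : ∀ i, ∀ v ∈ asympCone K, 0 ≤ recFn (f i) v := fun i v hv =>
    rec_nonneg (f i) (hdeg i) (fun x hx => hr x hx i) hv
  have hpos : ∀ i, ∀ v ∈ asympCone K, v ≠ 0 → 0 < recFn (f i) v := by
    intro i v hv hv0
    refine lt_of_le_of_ne (hnn i v hv) fun h0 => ?_
    obtain ⟨C, hC⟩ := isBounded_iff_forall_norm_le.1 hreg
    have hvn : 0 < ‖v‖ := norm_pos_iff.2 hv0
    have hc : 0 < (|C| + 1) / ‖v‖ := by positivity
    have hz : recFn (f i) (((|C| + 1) / ‖v‖) • v) = 0 := by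
      unfold recFn at h0 ⊢
      rw [hom_eval_smul (homogeneousComponent_isHomogeneous _ _), ← h0, mul_zero]
    have := hC (((|C| + 1) / ‖v‖) • v) ⟨cone_smul hv hc, fun y hy hlt => by
      have h1 := hlt i
      have h2 := hnn i y hy
      simp only at h1
      linarith⟩
    rw [norm_smul, Real.norm_of_nonneg hc.le, div_mul_cancel₀ _ hvn.ne'] at this
    linarith [le_abs_self C]
  have hsub : ∀ i c, Bornology.IsBounded {x | x ∈ K ∧ evalFn (f i) x ≤ c} := fun i c =>
    sublevel_bdd (f i) (hdeg i) (hpos i) c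
  have hcont : ∀ i, Continuous (evalFn (f i)) := fun i => eval_cont (f i)
  obtain ⟨x0, hx0⟩ := hK
  constructor
  · have hgc : Continuous fun x => ∑ i, evalFn (f i) x := continuous_finsetSum _ fun i _ => hcont i
    let i0 : Fin s := ⟨0, hs⟩
    have hcomp : IsCompact {x | x ∈ K ∧ ∑ i, evalFn (f i) x ≤ ∑ i, evalFn (f i) x0} := by
      refine Metric.isCompact_of_isClosed_isBounded
        (hKc.inter (isClosed_le hgc continuous_const)) ?_
      refine (hsub i0 (∑ i, evalFn (f i) x0 - ∑ i ∈ Finset.univ.erase i0, r i)).subset ?_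
      rintro x ⟨hxK, hx⟩
      refine ⟨hxK, ?_⟩
      have h1 := Finset.add_sum_erase Finset.univ (fun i => evalFn (f i) x) (Finset.mem_univ i0)
      have h2 : ∑ i ∈ Finset.univ.erase i0, r i ≤ ∑ i ∈ Finset.univ.erase i0, evalFn (f i) x :=
        Finset.sum_le_sum fun i _ => hr x hxK i
      linarith
    obtain ⟨z, hz, hmin⟩ := hcomp.exists_isMinOn ⟨x0, hx0, le_rfl⟩ hgc.continuousOn
    refine ⟨z, hz.1, ?_⟩
    rintro y hy ⟨hle, j, hj⟩
    have hlt : ∑ i, evalFn (f i) y < ∑ i, evalFn (f i) z :=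
      Finset.sum_lt_sum (fun i _ => hle i) ⟨j, Finset.mem_univ j, hj⟩
    have := hmin (show y ∈ {x | x ∈ K ∧ ∑ i, evalFn (f i) x ≤ ∑ i, evalFn (f i) x0} from
      ⟨hy, hlt.le.trans hz.2⟩)
    exact absurd hlt (not_lt.2 this)
  · refine Metric.isCompact_of_isClosed_isBounded ?_ ?_
    · have : SOLw K (fun i => evalFn (f i)) =
          K ∩ ⋂ y ∈ K, ⋃ i, {x | evalFn (f i) x ≤ evalFn (f i) y} := by
        ext x
        simp [SOLw]
      rw [this]
      refine hKc.inter (isClosed_biInter fun y _ => isClosed_iUnion_of_finite fun i =>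
        isClosed_le (hcont i) continuous_const)
    · refine (Bornology.isBounded_iUnion.2 fun i => hsub i (evalFn (f i) x0)).subset ?_
      rintro x ⟨hxK, hx⟩
      have := hx x0 hx0
      push Not at this
      obtain ⟨i, hi⟩ := this
      exact Set.mem_iUnion.2 ⟨i, hxK, hi⟩
end
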